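/- Every symmetric matrix A ∈ M₃(ℂ) (Aᵀ = A) is conjugate by a complex rotation R ∈ O₃(ℂ) (RᵀR = I₃) to a block-diagonal matrix whose blocks are each either a 1×1 scalar, or a I₂ + J₂ with J₂ = f₁f₁ᵀ (restricted to a 2-dimensional block), or a I₃ + J₃ with J₃ = f₁e₃ᵀ + e₃f₁ᵀ, for scalars a ∈ ℂ. -/

import Mathlib

open Matrix

noncomputable def f1 : Fin 3 → ℂ := (Real.sqrt 2 : ℂ)⁻¹ • ![1, -Complex.I, 0]
def e3 : Fin 3 → ℂ := ![0, 0, 1]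

/-- The symmetric Jordan block `J₂ = f₁f₁ᵀ` (as a 3×3 matrix acting on span{e₁,e₂}). -/
noncomputable def J2 : Matrix (Fin 3) (Fin 3) ℂ := vecMulVec f1 f1

/-- The symmetric Jordan block `J₃ = f₁e₃ᵀ + e₃f₁ᵀ`. -/
noncomputable def J3 : Matrix (Fin 3) (Fin 3) ℂ := vecMulVec f1 e3 + vecMulVec e3 f1

/-- Three vectors `u, w, v` form a null frame: `u, v` are isotropic with `u ⬝ᵥ v = 1` and
`w` is a unit vector orthogonal to both. -/
structure IsNullFrame (u w v : Fin 3 → ℂ) : Prop where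
  uu : u ⬝ᵥ u = 0
  vv : v ⬝ᵥ v = 0
  ww : w ⬝ᵥ w = 1
  uv : u ⬝ᵥ v = 1
  uw : u ⬝ᵥ w = 0
  vw : v ⬝ᵥ w = 0

theorem of_vec_mul_mul_transpose_apply (A : Matrix (Fin 3) (Fin 3) ℂ)
    (r : Fin 3 → Fin 3 → ℂ) (i j : Fin 3) :
    (of r * A * (of r)ᵀ) i j = r i ⬝ᵥ A *ᵥ r j := by
  rw [Matrix.mul_assoc]
  rfl

theorem of_vec_mul_transpose_apply (r : Fin 3 → Fin 3 → ℂ) (i j : Fin 3) :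
    (of r * (of r)ᵀ) i j = r i ⬝ᵥ r j := rfl

theorem dotProduct_mulVec_comm {A : Matrix (Fin 3) (Fin 3) ℂ} (hA : Aᵀ = A)
    (x y : Fin 3 → ℂ) : x ⬝ᵥ A *ᵥ y = y ⬝ᵥ A *ᵥ x := by
  rw [dotProduct_mulVec, ← mulVec_transpose, hA, dotProduct_comm]

theorem inv_sqrt_two_mul_self : (Real.sqrt 2 : ℂ)⁻¹ * (Real.sqrt 2 : ℂ)⁻¹ = 1 / 2 := by
  rw [← mul_inv, ← Complex.ofReal_mul, Real.mul_self_sqrt (by norm_num)]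
  norm_num

/-- The orthonormal triple attached to a null frame. -/
noncomputable def nullFrameRows (u w v : Fin 3 → ℂ) : Fin 3 → Fin 3 → ℂ :=
  ![(Real.sqrt 2 : ℂ)⁻¹ • (u + v), (Complex.I * (Real.sqrt 2 : ℂ)⁻¹) • (u - v), w]

namespace IsNullFrame

variable {u w v : Fin 3 → ℂ}

theorem rows_mul_transpose (h : IsNullFrame u w v) :
    of (nullFrameRows u w v) * (of (nullFrameRows u w v))ᵀ = 1 := by
  have vu : v ⬝ᵥ u = 1 := by rw [dotProduct_comm, h.uv]
  have wu : w ⬝ᵥ u = 0 := by rw [dotProduct_comm, h.uw]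
  have wv : w ⬝ᵥ v = 0 := by rw [dotProduct_comm, h.vw]
  have s := inv_sqrt_two_mul_self
  have hI := Complex.I_mul_I
  ext i j
  rw [of_vec_mul_transpose_apply]
  fin_cases i <;> fin_cases j <;>
    simp [nullFrameRows, h.uu, h.vv, h.ww, h.uv, h.uw, h.vw, vu, wu, wv, -mul_eq_zero,
      -Complex.ofReal_inv] <;> grind

theorem conj_eq (h : IsNullFrame u w v) {A : Matrix (Fin 3) (Fin 3) ℂ} (hA : Aᵀ = A)
    {a b β γ : ℂ} (hu : A *ᵥ u = a • u) (hww : w ⬝ᵥ A *ᵥ w = b) (hwv : w ⬝ᵥ A *ᵥ v = β)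
    (hvv : v ⬝ᵥ A *ᵥ v = γ) :
    of (nullFrameRows u w v) * A * (of (nullFrameRows u w v))ᵀ =
      diagonal ![a, a, b] + γ • J2 + β • J3 := by
  have vu : v ⬝ᵥ u = 1 := by rw [dotProduct_comm, h.uv]
  have wu : w ⬝ᵥ u = 0 := by rw [dotProduct_comm, h.uw]
  have hvw : v ⬝ᵥ A *ᵥ w = β := by rw [dotProduct_mulVec_comm hA, hwv]
  have huv : u ⬝ᵥ A *ᵥ v = a := by simp [dotProduct_mulVec_comm hA u, hu, vu]
  have huw : u ⬝ᵥ A *ᵥ w = 0 := by simp [dotProduct_mulVec_comm hA u, hu, wu]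
  have s := inv_sqrt_two_mul_self
  have hI := Complex.I_mul_I
  ext i j
  rw [of_vec_mul_mul_transpose_apply]
  fin_cases i <;> fin_cases j <;>
    simp [nullFrameRows, J2, J3, f1, e3, mulVec_add, mulVec_sub, mulVec_smul,
      hu, hww, hwv, hvv, hvw, huv, huw, h.uu, vu, wu, -mul_eq_zero, -Complex.ofReal_inv] <;> grind

theorem eq_sum (h : IsNullFrame u w v) (p : Fin 3 → ℂ) :
    p = (v ⬝ᵥ p) • u + (w ⬝ᵥ p) • w + (u ⬝ᵥ p) • v := by
  have hO := mul_eq_one_comm.mp h.rows_mul_transpose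
  have hp : (of (nullFrameRows u w v))ᵀ *ᵥ (of (nullFrameRows u w v) *ᵥ p) = p := by
    rw [mulVec_mulVec, hO, one_mulVec]
  have hr : of (nullFrameRows u w v) *ᵥ p = fun i => nullFrameRows u w v i ⬝ᵥ p := rfl
  have s := inv_sqrt_two_mul_self
  have hI := Complex.I_mul_I
  rw [hr] at hp
  ext i
  have hi := congrFun hp i
  simp only [mulVec, dotProduct, Fin.sum_univ_three, transpose_apply, of_apply, nullFrameRows,
    cons_val, Pi.smul_apply, Pi.add_apply, Pi.sub_apply, smul_eq_mul] at hi ⊢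
  grind

end IsNullFrame

theorem exists_dotProduct_eq_one {v : Fin 3 → ℂ} (hv : v ≠ 0) : ∃ x, v ⬝ᵥ x = 1 := by
  obtain ⟨i, hi⟩ := Function.ne_iff.mp hv
  exact ⟨Pi.single i (v i)⁻¹, by simpa using mul_inv_cancel₀ hi⟩

theorem exists_isNullFrame_of_orthogonal {u w : Fin 3 → ℂ} (hu : u ≠ 0) (huu : u ⬝ᵥ u = 0)
    (hww : w ⬝ᵥ w = 1) (huw : u ⬝ᵥ w = 0) : ∃ v, IsNullFrame u w v := by
  obtain ⟨x, hx⟩ := exists_dotProduct_eq_one hu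
  have hxu : x ⬝ᵥ u = 1 := by rw [dotProduct_comm, hx]
  have hwu : w ⬝ᵥ u = 0 := by rw [dotProduct_comm, huw]
  have hwx : w ⬝ᵥ x = x ⬝ᵥ w := dotProduct_comm _ _
  refine ⟨x - (x ⬝ᵥ w) • w - ((x ⬝ᵥ x - (x ⬝ᵥ w) ^ 2) / 2) • u, huu, ?_, hww, ?_, huw, ?_⟩ <;>
    simp [huu, hww, huw, hx, hxu, hwu, hwx]
  ring

theorem exists_isNullFrame {u : Fin 3 → ℂ} (hu : u ≠ 0) (huu : u ⬝ᵥ u = 0) :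
    ∃ w v, IsNullFrame u w v := by
  obtain ⟨x, hx⟩ := exists_dotProduct_eq_one hu
  have hxu : x ⬝ᵥ u = 1 := by rw [dotProduct_comm, hx]
  obtain ⟨v, hv⟩ := exists_isNullFrame_of_orthogonal (w := Complex.I • (u ⨯₃ x)) hu huu
    (by simp [cross_dot_cross, huu, hx, hxu]) (by simp)
  exact ⟨_, v, hv⟩

theorem exists_smul_dotProduct_self_eq_one {v : Fin 3 → ℂ} (hv : v ⬝ᵥ v ≠ 0) :
    ∃ c : ℂ, (c • v) ⬝ᵥ (c • v) = 1 := by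
  obtain ⟨s, hs⟩ := IsAlgClosed.exists_pow_nat_eq (v ⬝ᵥ v) (n := 2) (by norm_num)
  have hs0 : s ≠ 0 := by rintro rfl; simp at hs; exact hv hs.symm
  refine ⟨s⁻¹, ?_⟩
  simp only [smul_dotProduct, dotProduct_smul, smul_eq_mul, ← hs]
  field_simp

theorem exists_eigenvector (A : Matrix (Fin 3) (Fin 3) ℂ) :
    ∃ (a : ℂ) (v : Fin 3 → ℂ), v ≠ 0 ∧ A *ᵥ v = a • v := by
  obtain ⟨a, ha⟩ := Module.End.exists_eigenvalue (Matrix.toLin' A)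
  obtain ⟨v, hv⟩ := ha.exists_hasEigenvector
  exact ⟨a, v, hv.2, by simpa using hv.apply_eq_smul⟩

theorem exists_eigenvector_orthogonal {A : Matrix (Fin 3) (Fin 3) ℂ} (hA : Aᵀ = A)
    {w : Fin 3 → ℂ} {b : ℂ} (hw : A *ᵥ w = b • w) :
    ∃ (a : ℂ) (v : Fin 3 → ℂ), v ≠ 0 ∧ w ⬝ᵥ v = 0 ∧ A *ᵥ v = a • v := by
  let S : Submodule ℂ (Fin 3 → ℂ) := LinearMap.ker (dotProductBilin ℂ ℂ w)
  have hS : ∀ x, x ∈ S ↔ w ⬝ᵥ x = 0 := fun x => Iff.rfl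
  have hmap : ∀ x ∈ S, Matrix.toLin' A x ∈ S := fun x hx => by
    rw [hS] at hx ⊢
    rw [toLin'_apply, dotProduct_mulVec_comm hA, hw, dotProduct_smul, dotProduct_comm, hx,
      smul_zero]
  have : Nontrivial S := by
    by_cases h : w 0 = 0
    · exact Submodule.nontrivial_iff_ne_bot.mpr fun hb => by
        have : (![1, 0, 0] : Fin 3 → ℂ) ∈ S := by
          simp [hS, dotProduct, Fin.sum_univ_three, h]
        rw [hb, Submodule.mem_bot] at this
        simpa using congrFun this 0
    · exact Submodule.nontrivial_iff_ne_bot.mpr fun hb => h <| by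
        have : (![w 1, -w 0, 0] : Fin 3 → ℂ) ∈ S := by
          simp [hS, dotProduct, Fin.sum_univ_three]; ring
        rw [hb, Submodule.mem_bot] at this
        simpa using congrFun this 1
  obtain ⟨a, ha⟩ := Module.End.exists_eigenvalue ((Matrix.toLin' A).restrict hmap)
  obtain ⟨v, hv⟩ := ha.exists_hasEigenvector
  refine ⟨a, v, fun h => hv.2 (Subtype.ext h), v.2, ?_⟩
  simpa using congrArg Subtype.val hv.apply_eq_smul

theorem exists_conj_diagonal {A : Matrix (Fin 3) (Fin 3) ℂ} (hA : Aᵀ = A)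
    {w v : Fin 3 → ℂ} {a b : ℂ} (hww : w ⬝ᵥ w = 1) (hvv : v ⬝ᵥ v = 1) (hwv : w ⬝ᵥ v = 0)
    (hw : A *ᵥ w = b • w) (hv : A *ᵥ v = a • v) :
    ∃ R : Matrix (Fin 3) (Fin 3) ℂ, Rᵀ * R = 1 ∧
      ∃ a₁ a₂ a₃ : ℂ, Rᵀ * A * R = diagonal ![a₁, a₂, a₃] := by
  have hvw : v ⬝ᵥ w = 0 := by rw [dotProduct_comm, hwv]
  have hc (x : Fin 3 → ℂ) : (w ⨯₃ v) ⬝ᵥ x = x ⬝ᵥ (w ⨯₃ v) := dotProduct_comm _ _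
  refine ⟨(of ![w, v, w ⨯₃ v])ᵀ, ?_, b, a, (w ⨯₃ v) ⬝ᵥ A *ᵥ (w ⨯₃ v), ?_⟩ <;>
    rw [transpose_transpose] <;> ext i j
  · rw [of_vec_mul_transpose_apply]
    fin_cases i <;> fin_cases j <;> simp [hww, hvv, hwv, hvw, hc, cross_dot_cross]
  · rw [of_vec_mul_mul_transpose_apply]
    fin_cases i <;> fin_cases j <;>
      simp [hw, hv, hww, hvv, hwv, hvw, hc, dotProduct_mulVec_comm hA _ (w ⨯₃ v)]

/-- Every symmetric complex 3×3 matrix is conjugate by a complex rotation to a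
symmetric Jordan form: diagonal, `(aI₂+J₂) ⊕ (b)`, or `aI₃ + J₃`. -/
theorem symmetric_jordan_form (A : Matrix (Fin 3) (Fin 3) ℂ) (hA : Aᵀ = A) :
    ∃ R : Matrix (Fin 3) (Fin 3) ℂ, Rᵀ * R = 1 ∧
      ((∃ a₁ a₂ a₃ : ℂ, Rᵀ * A * R = Matrix.diagonal ![a₁, a₂, a₃]) ∨
       (∃ a b : ℂ, Rᵀ * A * R = Matrix.diagonal ![a, a, b] + J2) ∨
       (∃ a : ℂ, Rᵀ * A * R = a • (1 : Matrix (Fin 3) (Fin 3) ℂ) + J3)) := by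
  by_cases hex : ∃ (b : ℂ) (w : Fin 3 → ℂ), w ⬝ᵥ w ≠ 0 ∧ A *ᵥ w = b • w
  · obtain ⟨b, w, hw0, hw⟩ := hex
    obtain ⟨c, hc⟩ := exists_smul_dotProduct_self_eq_one hw0
    replace hw : A *ᵥ (c • w) = b • (c • w) := by rw [mulVec_smul, hw, smul_comm]
    generalize c • w = w at hc hw
    obtain ⟨a, v, hv0, hwv, hv⟩ := exists_eigenvector_orthogonal hA hw
    by_cases hvv : v ⬝ᵥ v = 0
    · obtain ⟨x, hx⟩ := exists_isNullFrame_of_orthogonal hv0 hvv hc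
        (by rw [dotProduct_comm, hwv])
      have hww : w ⬝ᵥ A *ᵥ w = b := by simp [hw, hc]
      have hwx : w ⬝ᵥ A *ᵥ x = 0 := by
        rw [dotProduct_mulVec_comm hA, hw, dotProduct_smul, hx.vw, smul_zero]
      by_cases hγ : x ⬝ᵥ A *ᵥ x = 0
      · refine ⟨(of (nullFrameRows v w x))ᵀ, ?_, .inl ⟨a, a, b, ?_⟩⟩ <;>
          rw [transpose_transpose]
        · exact hx.rows_mul_transpose
        · rw [hx.conj_eq hA hv hww hwx hγ]; simp
      · obtain ⟨s, hs⟩ := IsAlgClosed.exists_pow_nat_eq (x ⬝ᵥ A *ᵥ x) (n := 2) (by norm_num)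
        have hs0 : s ≠ 0 := by rintro rfl; simp at hs; exact hγ hs.symm
        have hf : IsNullFrame (s • v) w (s⁻¹ • x) := by
          constructor <;> simp [hx.uu, hx.vv, hx.ww, hx.uv, hx.uw, hx.vw, hs0]
        refine ⟨(of (nullFrameRows (s • v) w (s⁻¹ • x)))ᵀ, ?_, .inr (.inl ⟨a, b, ?_⟩)⟩ <;>
          rw [transpose_transpose]
        · exact hf.rows_mul_transpose
        · rw [hf.conj_eq hA (a := a) (b := b) (β := 0) (γ := 1)]
          · simp
          · rw [mulVec_smul, hv, smul_comm]
          · exact hww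
          · simp [mulVec_smul, hwx]
          · simp only [mulVec_smul, smul_dotProduct, dotProduct_smul, smul_eq_mul, ← hs]
            field_simp
    · obtain ⟨d, hd⟩ := exists_smul_dotProduct_self_eq_one hvv
      obtain ⟨R, hR, h⟩ := exists_conj_diagonal hA (v := d • v) (a := a) hc hd
        (by simp [hwv]) hw (by rw [mulVec_smul, hv, smul_comm])
      exact ⟨R, hR, .inl h⟩
  · push Not at hex
    obtain ⟨a, u, hu0, hu⟩ := exists_eigenvector A
    have huu : u ⬝ᵥ u = 0 := by_contra fun h => hex a u h hu
    obtain ⟨w, v, hf⟩ := exists_isNullFrame hu0 huu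
    have huw : u ⬝ᵥ A *ᵥ w = 0 := by
      rw [dotProduct_mulVec_comm hA, hu, dotProduct_smul, dotProduct_comm, hf.uw, smul_zero]
    have huv : u ⬝ᵥ A *ᵥ v = a := by
      rw [dotProduct_mulVec_comm hA, hu, dotProduct_smul, dotProduct_comm, hf.uv, smul_eq_mul,
        mul_one]
    have hwu : w ⬝ᵥ u = 0 := by rw [dotProduct_comm, hf.uw]
    have hAw : A *ᵥ w = (v ⬝ᵥ A *ᵥ w) • u + (w ⬝ᵥ A *ᵥ w) • w := by
      simpa [huw] using hf.eq_sum (A *ᵥ w)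
    obtain ⟨b, hb⟩ : ∃ b, w ⬝ᵥ A *ᵥ w = b := ⟨_, rfl⟩
    obtain ⟨β, hβ⟩ : ∃ β, v ⬝ᵥ A *ᵥ w = β := ⟨_, rfl⟩
    obtain ⟨γ, hγ⟩ : ∃ γ, v ⬝ᵥ A *ᵥ v = γ := ⟨_, rfl⟩
    have hβ' : w ⬝ᵥ A *ᵥ v = β := by rw [dotProduct_mulVec_comm hA, hβ]
    rw [hb, hβ] at hAw
    have hba : b = a := by
      by_contra hne
      have hne' : b - a ≠ 0 := sub_ne_zero.mpr hne
      refine hex b (w + (β / (b - a)) • u) (by simp [hf.ww, hf.uw, hwu, huu]) ?_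
      rw [mulVec_add, mulVec_smul, hAw, hu]
      ext i
      simp only [Pi.add_apply, Pi.smul_apply, smul_eq_mul]
      field_simp
      ring
    have hβ0 : β ≠ 0 := by
      rintro rfl
      exact hex b w (by simp [hf.ww]) (by simpa using hAw)
    obtain ⟨t, ht⟩ : ∃ t, γ = 2 * β * t := ⟨γ / (2 * β), by field_simp⟩
    have hvu : v ⬝ᵥ u = 1 := by rw [dotProduct_comm, hf.uv]
    have hwv : w ⬝ᵥ v = 0 := by rw [dotProduct_comm, hf.vw]
    have hg : IsNullFrame (β • u) (w + t • u) (β⁻¹ • (v - t • w - (t ^ 2 / 2) • u)) := by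
      constructor <;>
        simp [hf.uu, hf.vv, hf.ww, hf.uv, hf.uw, hf.vw, hwu, hvu, hwv, hβ0]
      all_goals ring
    refine ⟨(of (nullFrameRows (β • u) (w + t • u)
      (β⁻¹ • (v - t • w - (t ^ 2 / 2) • u))))ᵀ, ?_, .inr (.inr ⟨a, ?_⟩)⟩ <;>
      rw [transpose_transpose]
    · exact hg.rows_mul_transpose
    · rw [hg.conj_eq hA (a := a) (b := a) (β := 1) (γ := 0)]
      · rw [zero_smul, add_zero, one_smul]
        congr 1
        ext i j
        fin_cases i <;> fin_cases j <;> simp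
      · rw [mulVec_smul, hu, smul_comm]
      · simp [mulVec_add, mulVec_smul, hu, huw, hb, hba, hf.uu, hwu]
      · simp [mulVec_sub, mulVec_smul, hu, huw, huv, hb, hba, hβ', hf.uu, hwu]
        field_simp
      · simp [mulVec_sub, mulVec_smul, hu, huw, huv, hb, hba, hβ, hβ', hγ, hf.uu, hwu, hvu,
          -mul_eq_zero]
        rw [ht]
        ring
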